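/- There exist absolute constants c, C ∈ (0,1) such that the following holds. Let d ≥ 6, 0 < ε < C, and d²/2 ≤ ℓ ≤ d² − 1. Let V₁, …, V_ℓ ∈ ℂ^{d×d} be Hermitian, traceless, and orthonormal with respect to the Hilbert–Schmidt inner product. For z ∈ {−1,+1}^ℓ, set Δ_z = (cε/√(dℓ))·∑_{i=1}^ℓ z_i V_i, let N_z = min{1, 1/(d‖Δ_z‖_∞)}, Δ̄_z = N_z·Δ_z, and ρ_z = I_d/d + Δ̄_z. Then for every n ≥ 1, D_{χ²}( E_z[ ρ_z^{⊗n} ] ‖ (I_d/d)^{⊗n} ) ≤ exp( n² c⁴ ε⁴ / (2ℓ) ) − 1 + 4e^{−d}, where z is uniform on {−1,+1}^ℓ. -/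

import Mathlib

open Matrix

/-- ℓ₂→ℓ₂ operator norm of a complex matrix. -/
noncomputable def opNorm {n : Type*} [Fintype n] [DecidableEq n] (M : Matrix n n ℂ) : ℝ :=
  ‖Matrix.toEuclideanCLM (𝕜 := ℂ) M‖

/-- The `n`-fold Kronecker product of a family of `d×d` matrices. -/
noncomputable def kronFam (n d : ℕ) (M : Fin n → Matrix (Fin d) (Fin d) ℂ) :
    Matrix (Fin n → Fin d) (Fin n → Fin d) ℂ :=
  Matrix.of fun x y => ∏ i, M i (x i) (y i)

/-- The Rademacher sign associated to a Boolean. -/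
def sgn (b : Bool) : ℂ := if b then 1 else -1

/-- The Rademacher sign associated to a Boolean, as a real number. -/
def realSgn (b : Bool) : ℝ := if b then 1 else -1

theorem sgn_eq_ofReal (b : Bool) : sgn b = (realSgn b : ℂ) := by
  cases b <;> simp [sgn, realSgn]

theorem realSgn_not (b : Bool) : realSgn (!b) = -realSgn b := by
  cases b <;> simp [realSgn]

theorem abs_realSgn (b : Bool) : |realSgn b| = 1 := by
  cases b <;> simp [realSgn]

/-- The inner product of two sign vectors. -/
def signInner {l : ℕ} (z w : Fin l → Bool) : ℝ := ∑ j, realSgn (z j) * realSgn (w j)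

theorem signInner_not {l : ℕ} (z w : Fin l → Bool) :
    signInner (fun j => !z j) w = -signInner z w := by
  simp [signInner, realSgn_not]

theorem abs_signInner_le {l : ℕ} (z w : Fin l → Bool) : |signInner z w| ≤ l := by
  refine (Finset.abs_sum_le_sum_abs _ _).trans ?_
  simp [abs_mul, abs_realSgn]

theorem kronFam_smul_one (n d : ℕ) (a : ℂ) :
    kronFam n d (fun _ => a • 1) = a ^ n • 1 := by
  ext x y
  simp only [kronFam, Matrix.of_apply, Matrix.smul_apply, smul_eq_mul, Finset.prod_mul_distrib,
    Finset.prod_const, Finset.card_univ, Fintype.card_fin, Matrix.one_apply]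
  congr 1
  rw [Finset.prod_ite_zero]
  simp [funext_iff]

theorem trace_kronFam_mul_kronFam (n d : ℕ) (A B : Fin n → Matrix (Fin d) (Fin d) ℂ) :
    (kronFam n d A * kronFam n d B).trace = ∏ i, (A i * B i).trace := by
  simp only [kronFam, Matrix.trace, Matrix.diag_apply, Matrix.mul_apply, Matrix.of_apply,
    ← Finset.prod_mul_distrib]
  rw [Fintype.prod_sum]
  refine Finset.sum_congr rfl fun x _ => ?_
  rw [Fintype.prod_sum]

theorem opNorm_neg {m : Type*} [Fintype m] [DecidableEq m] (M : Matrix m m ℂ) :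
    opNorm (-M) = opNorm M := by
  simp [opNorm]

theorem opNorm_nonneg {m : Type*} [Fintype m] [DecidableEq m] (M : Matrix m m ℂ) :
    0 ≤ opNorm M := norm_nonneg _

/-- The sum of `exp ∘ g` for an odd function `g` of a sign vector is the sum of `cosh ∘ g`. -/
theorem sum_exp_eq_sum_cosh {l : ℕ} (g : (Fin l → Bool) → ℝ)
    (hg : ∀ z, g (fun j => !z j) = -g z) :
    ∑ z, Real.exp (g z) = ∑ z, Real.cosh (g z) := by
  have h : ∑ z, Real.exp (g z) = ∑ z, Real.exp (-g z) := by
    simp only [← hg]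
    exact (Equiv.sum_comp (Equiv.piCongrRight fun _ : Fin l => Equiv.boolNot)
      fun z => Real.exp (g z)).symm
  simp only [Real.cosh_eq, ← Finset.sum_div, Finset.sum_add_distrib, ← h]
  ring

/-- Hoeffding's bound for the moment generating function of a Rademacher sum. -/
theorem sum_exp_mul_signInner_le {l : ℕ} (t : ℝ) (w : Fin l → Bool) :
    ∑ z, Real.exp (t * signInner z w) ≤ 2 ^ l * Real.exp (l * (t ^ 2 / 2)) := by
  have h : ∀ j, ∑ b, Real.exp (t * (realSgn b * realSgn (w j))) = 2 * Real.cosh t := by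
    intro j
    cases w j <;> simp [realSgn, Real.cosh_eq] <;> ring
  simp only [signInner, Finset.mul_sum, Real.exp_sum]
  rw [← Fintype.prod_sum fun (j : Fin l) (b : Bool) =>
    Real.exp (t * (realSgn b * realSgn (w j)))]
  simp only [h, Finset.prod_const, Finset.card_univ, Fintype.card_fin, mul_pow]
  rw [Real.exp_nat_mul]
  gcongr
  exact Real.cosh_le_exp_half_sq t

/-- Even weights in `[0, 1]` do not spoil the Rademacher moment bound. -/
theorem sum_sum_one_add_weighted_pow_le {l : ℕ} (hl : 0 < l) (n : ℕ) (N : (Fin l → Bool) → ℝ)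
    (hN0 : ∀ z, 0 ≤ N z) (hN1 : ∀ z, N z ≤ 1) (hN : ∀ z, N (fun j => !z j) = N z)
    {a : ℝ} (ha0 : 0 ≤ a) (ha1 : a ≤ 1) :
    ∑ z, ∑ w, (1 + N z * N w * (a / l * signInner z w)) ^ n
      ≤ 4 ^ l * Real.exp ((n : ℝ) ^ 2 * a ^ 2 / (2 * l)) := by
  have hl' : (0 : ℝ) < l := by exact_mod_cast hl
  have hNN : ∀ z w, |N z * N w| ≤ 1 := fun z w => by
    rw [abs_of_nonneg (mul_nonneg (hN0 z) (hN0 w))]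
    exact mul_le_one₀ (hN1 z) (hN0 w) (hN1 w)
  have hpow : ∀ z w, (1 + N z * N w * (a / l * signInner z w)) ^ n
      ≤ Real.exp (N z * N w * (n * a / l * signInner z w)) := by
    intro z w
    have hx : |N z * N w * (a / l * signInner z w)| ≤ 1 := by
      rw [abs_mul]
      refine mul_le_one₀ (hNN z w) (abs_nonneg _) ?_
      rw [abs_mul, abs_of_nonneg (by positivity)]
      calc a / l * |signInner z w| ≤ a / l * l := by gcongr; exact abs_signInner_le z w
        _ = a := by field_simp
        _ ≤ 1 := ha1
    calc _ ≤ Real.exp (N z * N w * (a / l * signInner z w)) ^ n := by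
          refine pow_le_pow_left₀ (by linarith [(abs_le.1 hx).1]) ?_ n
          linarith [Real.add_one_le_exp (N z * N w * (a / l * signInner z w))]
      _ = _ := by rw [← Real.exp_nat_mul]; congr 1; ring
  have hw : ∀ w, ∑ z, (1 + N z * N w * (a / l * signInner z w)) ^ n
      ≤ 2 ^ l * Real.exp (l * ((n * a / l) ^ 2 / 2)) := by
    intro w
    calc _ ≤ ∑ z, Real.exp (N z * N w * (n * a / l * signInner z w)) :=
          Finset.sum_le_sum fun z _ => hpow z w
      _ = ∑ z, Real.cosh (N z * N w * (n * a / l * signInner z w)) :=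
          sum_exp_eq_sum_cosh _ fun z => by rw [hN, signInner_not]; ring
      _ ≤ ∑ z, Real.cosh (n * a / l * signInner z w) := by
          refine Finset.sum_le_sum fun z _ => Real.cosh_le_cosh.2 ?_
          rw [abs_mul]
          exact mul_le_of_le_one_left (abs_nonneg _) (hNN z w)
      _ = ∑ z, Real.exp (n * a / l * signInner z w) :=
          (sum_exp_eq_sum_cosh _ fun z => by rw [signInner_not]; ring).symm
      _ ≤ _ := sum_exp_mul_signInner_le _ w
  rw [Finset.sum_comm]
  refine (Finset.sum_le_sum fun w _ => hw w).trans_eq ?_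
  have he : (l : ℝ) * ((n * a / l) ^ 2 / 2) = (n : ℝ) ^ 2 * a ^ 2 / (2 * l) := by
    field_simp
  have h4 : (4 : ℝ) ^ l = 2 ^ l * 2 ^ l := by rw [← mul_pow]; norm_num
  simp [he, h4, mul_assoc]

theorem trace_signed_sum_mul {d l : ℕ} {V : Fin l → Matrix (Fin d) (Fin d) ℂ}
    (hV : ∀ i, (V i).IsHermitian)
    (hVV : ∀ i j, ((V i)ᴴ * V j).trace = if i = j then 1 else 0) (z w : Fin l → Bool) :
    ((∑ j, sgn (z j) • V j) * ∑ j, sgn (w j) • V j).trace = (signInner z w : ℂ) := by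
  have h : ∀ i j, (V i * V j).trace = if i = j then 1 else 0 := fun i j => by
    rw [← hVV i j, (hV i).eq]
  simp [Finset.sum_mul, Finset.mul_sum, Matrix.trace_sum, h, signInner, sgn_eq_ofReal, mul_comm]

theorem trace_perturbed_mul {d : ℕ} (hd : d ≠ 0) {A B : Matrix (Fin d) (Fin d) ℂ}
    (hA : A.trace = 0) (hB : B.trace = 0) :
    d * (((d : ℂ)⁻¹ • 1 + A) * ((d : ℂ)⁻¹ • 1 + B)).trace = 1 + d * (A * B).trace := by
  have : (d : ℂ) ≠ 0 := by exact_mod_cast hd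
  simp only [add_mul, mul_add, Matrix.smul_mul, Matrix.mul_smul, Matrix.one_mul, Matrix.mul_one,
    Matrix.trace_add, Matrix.trace_smul, hA, hB, Matrix.trace_one, Fintype.card_fin, smul_eq_mul]
  field_simp
  ring

/-- The trace in the `χ²`-divergence of a uniform mixture of tensor powers from the maximally
mixed state. -/
theorem trace_inv_mul_mixture_mul_mixture {ι : Type*} [Fintype ι] {n d : ℕ} (hd : d ≠ 0) (k : ℂ)
    (ρ : ι → Matrix (Fin d) (Fin d) ℂ) :
    ((kronFam n d fun _ => (d : ℂ)⁻¹ • 1)⁻¹ * (k • ∑ z, kronFam n d fun _ => ρ z) *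
      (k • ∑ z, kronFam n d fun _ => ρ z)).trace
      = k ^ 2 * ∑ z, ∑ w, (d * (ρ z * ρ w).trace) ^ n := by
  have hd' : (d : ℂ) ≠ 0 := by exact_mod_cast hd
  have hinv : (kronFam n d fun _ => (d : ℂ)⁻¹ • 1)⁻¹ = (d : ℂ) ^ n • 1 := by
    refine Matrix.inv_eq_left_inv ?_
    rw [kronFam_smul_one, Matrix.smul_mul, Matrix.mul_smul, Matrix.one_mul, smul_smul, ← mul_pow,
      mul_inv_cancel₀ hd', one_pow, one_smul]
  rw [hinv]
  simp only [Matrix.smul_mul, Matrix.mul_smul, Matrix.one_mul, Matrix.trace_smul, Finset.sum_mul,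
    Finset.mul_sum, Matrix.trace_sum, trace_kronFam_mul_kronFam, Finset.prod_const,
    Finset.card_univ, Fintype.card_fin, smul_eq_mul, mul_pow]
  rw [Finset.sum_comm]
  refine Finset.sum_congr rfl fun z _ => Finset.sum_congr rfl fun w _ => ?_
  ring

/-- Centralized mixedness-testing bound: there are absolute constants `c, C ∈ (0,1)` so that
for the hard ensemble `ρ_z = I/d + Δ̄_z` built from Hermitian traceless Hilbert–Schmidt
orthonormal `V₁,…,V_ℓ` with `d²/2 ≤ ℓ ≤ d²−1`, for every `n ≥ 1`,
`D_{χ²}(E_z[ρ_z^{⊗n}] ‖ (I/d)^{⊗n}) ≤ exp(n²c⁴ε⁴/(2ℓ)) − 1 + 4e^{−d}`. -/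
theorem stmt13 :
    ∃ c C : ℝ, 0 < c ∧ c < 1 ∧ 0 < C ∧ C < 1 ∧
    ∀ (d l : ℕ) (ε : ℝ),
      6 ≤ d → 0 < ε → ε < C → d ^ 2 ≤ 2 * l → l + 1 ≤ d ^ 2 →
    ∀ (V : Fin l → Matrix (Fin d) (Fin d) ℂ),
      (∀ i, (V i).IsHermitian) → (∀ i, (V i).trace = 0) →
      (∀ i j, ((V i)ᴴ * V j).trace = if i = j then 1 else 0) →
    ∀ (n : ℕ), 1 ≤ n →
    let Δ : (Fin l → Bool) → Matrix (Fin d) (Fin d) ℂ :=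
      fun z => (((c * ε / Real.sqrt ((d : ℝ) * l) : ℝ) : ℂ)) • ∑ j, sgn (z j) • V j
    let ρ : (Fin l → Bool) → Matrix (Fin d) (Fin d) ℂ :=
      fun z => ((d : ℂ))⁻¹ • 1 +
        (((min 1 (1 / ((d : ℝ) * opNorm (Δ z))) : ℝ) : ℂ)) • Δ z
    let ρbar : Matrix (Fin n → Fin d) (Fin n → Fin d) ℂ :=
      (((2 : ℂ)) ^ l)⁻¹ • ∑ z : Fin l → Bool, kronFam n d (fun _ => ρ z)
    let σm : Matrix (Fin n → Fin d) (Fin n → Fin d) ℂ :=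
      kronFam n d (fun _ => ((d : ℂ))⁻¹ • 1)
    ((σm⁻¹ * ρbar * ρbar).trace).re - 1
      ≤ Real.exp ((n : ℝ) ^ 2 * c ^ 4 * ε ^ 4 / (2 * l)) - 1 + 4 * Real.exp (-(d : ℝ)) := by
  refine ⟨1 / 2, 1 / 2, by norm_num, by norm_num, by norm_num, by norm_num, ?_⟩
  intro d l ε hd hε0 hε1 hl _ V hV hVtr hVV n _ Δ ρ ρbar σm
  have hd0 : d ≠ 0 := by omega
  have hl0 : 0 < l := by
    have : 0 < d ^ 2 := by positivity
    omega
  have hd' : (d : ℝ) ≠ 0 := by exact_mod_cast hd0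
  have hl' : (l : ℝ) ≠ 0 := by exact_mod_cast hl0.ne'
  set N : (Fin l → Bool) → ℝ := fun z => min 1 (1 / ((d : ℝ) * opNorm (Δ z))) with hN
  set a : ℝ := (1 / 2 * ε) ^ 2 with ha
  have hΔnot : ∀ z, Δ (fun j => !z j) = -Δ z := fun z => by
    simp [Δ, sgn_eq_ofReal, realSgn_not]
  have hΔtr : ∀ z, (Δ z).trace = 0 := fun z => by
    simp [Δ, Matrix.trace_sum, hVtr]
  have hsq : (1 / 2 * ε / Real.sqrt ((d : ℝ) * l)) * (1 / 2 * ε / Real.sqrt ((d : ℝ) * l))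
      = a / (d * l) := by
    rw [div_mul_div_comm, Real.mul_self_sqrt (by positivity), ha, sq]
  have hΔΔ : ∀ z w, (Δ z * Δ w).trace = ((a / (d * l) * signInner z w : ℝ) : ℂ) := by
    intro z w
    simp only [Δ, Matrix.smul_mul, Matrix.mul_smul, Matrix.trace_smul,
      trace_signed_sum_mul hV hVV, smul_eq_mul]
    rw [← mul_assoc, ← Complex.ofReal_mul, hsq, ← Complex.ofReal_mul]
  have hρ : ∀ z w, d * (ρ z * ρ w).trace
      = ((1 + N z * N w * (a / l * signInner z w) : ℝ) : ℂ) := by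
    intro z w
    have key : (d : ℝ) * (N z * (N w * (a / (d * l) * signInner z w)))
        = N z * N w * (a / l * signInner z w) := by
      field_simp
    have := trace_perturbed_mul hd0 (A := (N z : ℂ) • Δ z) (B := (N w : ℂ) • Δ w)
      (by simp [hΔtr]) (by simp [hΔtr])
    rw [Matrix.smul_mul, Matrix.mul_smul, Matrix.trace_smul, Matrix.trace_smul, hΔΔ] at this
    refine this.trans ?_
    rw [← key]
    push_cast
    simp only [smul_eq_mul]
  have htr : (σm⁻¹ * ρbar * ρbar).trace
      = (((2 ^ l)⁻¹ ^ 2 * ∑ z, ∑ w, (1 + N z * N w * (a / l * signInner z w)) ^ n : ℝ) : ℂ) := by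
    refine (trace_inv_mul_mixture_mul_mixture hd0 _ ρ).trans ?_
    simp only [hρ]
    push_cast
    rfl
  have hmain := sum_sum_one_add_weighted_pow_le hl0 n N
    (fun z => le_min zero_le_one
      (one_div_nonneg.2 (mul_nonneg d.cast_nonneg (opNorm_nonneg _))))
    (fun z => min_le_left _ _) (fun z => by simp only [hN, hΔnot, opNorm_neg])
    (a := a) (by positivity) (by rw [ha]; nlinarith)
  have h4 : ((2 : ℝ) ^ l)⁻¹ ^ 2 * 4 ^ l = 1 := by
    rw [inv_pow, ← pow_mul, mul_comm l, pow_mul]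
    norm_num
  have hbound : (σm⁻¹ * ρbar * ρbar).trace.re ≤ Real.exp ((n : ℝ) ^ 2 * a ^ 2 / (2 * l)) := by
    rw [htr, Complex.ofReal_re]
    calc _ ≤ ((2 : ℝ) ^ l)⁻¹ ^ 2 * (4 ^ l * Real.exp ((n : ℝ) ^ 2 * a ^ 2 / (2 * l))) := by
          gcongr
      _ = _ := by rw [← mul_assoc, h4, one_mul]
  have hexp : (n : ℝ) ^ 2 * (1 / 2) ^ 4 * ε ^ 4 / (2 * l) = (n : ℝ) ^ 2 * a ^ 2 / (2 * l) := by
    rw [ha]; ring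
  rw [hexp]
  linarith [Real.exp_pos (-(d : ℝ))]
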